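/- Let n be a nonnegative integer and a, b, c, d, e, f, p, q ∈ ℂ satisfying the Saalschütz-type condition d+e+f−a−b−c+n = 3. Assume (c−q)(d−a−b−1) ≠ 0, ab + p(d−a−b−1) ≠ 0 and (e−c−1)(f−c−1) − (c−q)(d−a−b−1) ≠ 0, and set α = q(e−c−1)(f−c−1)/((c−q)(d−a−b−1)), γ = p(d−a−1)(d−b−1)/(ab + p(d−a−b−1)), δ = (q(e−c−1)(f−c−1) + n(c−q)(d−a−b−1))/((e−c−1)(f−c−1) − (c−q)(d−a−b−1)). Assume the parameters are nondegenerate for the identity below. Then ₆F₅(a, b, c, p+1, q+1, −n; d, e, f, p, q; 1) = ((e−c−1)_n (f−c−1)_n (α+1)_n / ((e)_n (f)_n (α)_n)) · ₆F₅(d−a−1, d−b−1, c, γ+1, δ+1, −n; d, 2+c−e−n, 2+c−f−n, γ, δ; 1). -/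

import Mathlib

/-- Rising factorial (Pochhammer symbol) `(a)ₖ = a(a+1)⋯(a+k−1)`. -/
noncomputable def poch (a : ℂ) (k : ℕ) : ℂ := (ascPochhammer ℂ k).eval a

/-- Terminating hypergeometric sum with numerator parameters `A` together with
the extra top parameter `-n`, denominator parameters `B`, and argument `x`. -/
noncomputable def hypTerm (A B : List ℂ) (n : ℕ) (x : ℂ) : ℂ :=
  ∑ k ∈ Finset.range (n + 1),
    ((A.map fun a => poch a k).prod * poch (-(n : ℂ)) k) /
      ((k.factorial : ℂ) * (B.map fun b => poch b k).prod) * x ^ k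

open Finset

theorem sum_antidiagonal_choose_mul_fst (n : ℕ) (g : ℕ → ℕ → ℂ) :
    ∑ x ∈ antidiagonal (n + 1), ((n + 1).choose x.1 : ℂ) * (x.1 * g x.1 x.2) =
      (n + 1) * ∑ x ∈ antidiagonal n, (n.choose x.1 : ℂ) * g (x.1 + 1) x.2 := by
  rw [Finset.Nat.sum_antidiagonal_succ, mul_sum]
  simp only [Nat.cast_zero, zero_mul, mul_zero, zero_add]
  refine Finset.sum_congr rfl fun x _ => ?_
  have h : ((n + 1 : ℕ) : ℂ) * n.choose x.1 = (n + 1).choose (x.1 + 1) * (x.1 + 1 : ℕ) := by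
    exact_mod_cast Nat.add_one_mul_choose_eq n x.1
  push_cast at h ⊢
  linear_combination -g (x.1 + 1) x.2 * h

theorem sum_antidiagonal_choose_mul_snd (n : ℕ) (g : ℕ → ℕ → ℂ) :
    ∑ x ∈ antidiagonal (n + 1), ((n + 1).choose x.1 : ℂ) * (x.2 * g x.1 x.2) =
      (n + 1) * ∑ x ∈ antidiagonal n, (n.choose x.1 : ℂ) * g x.1 (x.2 + 1) := by
  rw [Finset.Nat.sum_antidiagonal_succ', Finset.mul_sum]
  simp only [Nat.cast_zero, zero_mul, mul_zero, zero_add]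
  refine Finset.sum_congr rfl fun x hx => ?_
  have hx := mem_antidiagonal.1 hx
  have h : (n.choose x.1 : ℂ) * (n + 1 : ℕ) = (n + 1).choose x.1 * (x.2 + 1 : ℕ) := by
    have := Nat.choose_mul_succ_eq n x.1
    rw [show n + 1 - x.1 = x.2 + 1 by lia] at this
    exact_mod_cast this
  push_cast at h ⊢
  linear_combination -g x.1 (x.2 + 1) * h

theorem sum_antidiagonal_choose_mul_shift (n : ℕ) (g : ℕ → ℕ → ℂ) :
    ∑ x ∈ antidiagonal n, (n.choose x.1 : ℂ) * (x.2 * g (x.1 + 1) (x.2 - 1)) =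
      ∑ x ∈ antidiagonal n, (n.choose x.1 : ℂ) * (x.1 * g x.1 x.2) := by
  cases n with
  | zero => simp
  | succ n =>
    rw [sum_antidiagonal_choose_mul_fst, sum_antidiagonal_choose_mul_snd n
      fun i m => g (i + 1) (m - 1)]
    simp

theorem poch_zero (a : ℂ) : poch a 0 = 1 := by simp [poch]

theorem poch_succ (a : ℂ) (k : ℕ) : poch a (k + 1) = poch a k * (a + k) :=
  ascPochhammer_succ_eval k a

theorem poch_add (a : ℂ) (k m : ℕ) : poch a (k + m) = poch a k * poch (a + k) m := by
  induction m with
  | zero => simp [poch_zero]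
  | succ m ih => rw [← add_assoc, poch_succ, ih, poch_succ]; push_cast; ring

theorem poch_succ_left (a : ℂ) (k : ℕ) : poch a (k + 1) = a * poch (a + 1) k := by
  rw [add_comm k 1, poch_add, poch_succ, poch_zero]; simp

theorem mul_poch_add_one (a : ℂ) (k : ℕ) : a * poch (a + 1) k = poch a k * (a + k) := by
  rw [← poch_succ_left, poch_succ]

theorem poch_add_one_eq (a : ℂ) (k : ℕ) :
    poch (a + 1) k = poch a k + k * poch (a + 1) (k - 1) := by
  cases k with
  | zero => simp [poch_zero]
  | succ k => rw [poch_succ, poch_succ_left]; simp only [Nat.add_sub_cancel]; push_cast; ring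

theorem poch_reflect (a : ℂ) (k : ℕ) : poch a k = (-1) ^ k * poch (1 - a - k) k := by
  induction k with
  | zero => simp [poch_zero]
  | succ k ih =>
    rw [poch_succ, ih, poch_succ_left, pow_succ]
    push_cast
    rw [show 1 - a - ((k : ℂ) + 1) + 1 = 1 - a - k by ring]
    ring

/-- The Pfaff–Saalschütz summation in polynomial form. -/
theorem sum_poch_saalschutz (n : ℕ) (A B d : ℂ) :
    ∑ x ∈ antidiagonal n, (n.choose x.1 : ℂ) *
        (poch A x.1 * poch B x.1 * poch (d - A - B) x.2 * poch (d + x.1) x.2) =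
      poch (d - A) n * poch (d - B) n := by
  induction n with
  | zero => simp [poch_zero]
  | succ n ih =>
    rw [Finset.sum_antidiagonal_choose_succ_mul fun i m =>
      poch A i * poch B i * poch (d - A - B) m * poch (d + i) m]
    have hsplit : ∑ x ∈ antidiagonal n, (n.choose x.2 : ℂ) *
        (poch A (x.1 + 1) * poch B (x.1 + 1) * poch (d - A - B) x.2 *
          poch (d + (x.1 + 1 : ℕ)) x.2) =
        ∑ x ∈ antidiagonal n, (n.choose x.1 : ℂ) *
          (poch A x.1 * poch B x.1 * poch (d - A - B) x.2 * poch (d + x.1) x.2 *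
            ((A + x.1) * (B + x.1))) +
        ∑ x ∈ antidiagonal n, (n.choose x.1 : ℂ) *
          (x.1 * (poch A x.1 * poch B x.1 * poch (d - A - B) (x.2 + 1) *
            poch (d + x.1) x.2)) := by
      rw [← sum_antidiagonal_choose_mul_shift n fun i m =>
        poch A i * poch B i * poch (d - A - B) (m + 1) * poch (d + i) m,
        ← Finset.sum_add_distrib]
      refine Finset.sum_congr rfl fun x hx => ?_
      rw [← Nat.choose_symm_of_eq_add (mem_antidiagonal.1 hx).symm]
      have h := poch_add_one_eq (d + x.1) x.2
      push_cast
      rw [← add_assoc, h, poch_succ, poch_succ]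
      rcases Nat.eq_zero_or_pos x.2 with h0 | h0
      · rw [h0]; push_cast; ring
      · rw [Nat.sub_add_cancel h0]; ring
    rw [hsplit, poch_succ, poch_succ, mul_mul_mul_comm, ← ih, Finset.sum_mul,
      ← Finset.sum_add_distrib, ← Finset.sum_add_distrib]
    refine Finset.sum_congr rfl fun x hx => ?_
    have hx : (x.1 : ℂ) + x.2 = n := by exact_mod_cast mem_antidiagonal.1 hx
    rw [poch_succ, poch_succ, ← hx]
    ring

/-- The Saalschütz summation with an extra pair of parameters differing by one, in polynomial
form. -/
theorem sum_poch_saalschutz_extended (n : ℕ) (A B d γ : ℂ) :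
    ∑ x ∈ antidiagonal (n + 1), ((n + 1).choose x.1 : ℂ) *
        (poch A x.1 * poch B x.1 * poch (d - 1 - A - B) x.2 * poch (d + x.1) x.2 *
          (γ + x.1)) =
      poch (d - A) n * poch (d - B) n *
        (γ * (d - 1 - A) * (d - 1 - B) + (n + 1) * (A * B + γ * (d - 1 - A - B))) := by
  have hfst : ∑ x ∈ antidiagonal (n + 1), ((n + 1).choose x.1 : ℂ) *
      (x.1 * (poch A x.1 * poch B x.1 * poch (d - 1 - A - B) x.2 * poch (d + x.1) x.2)) =
      (n + 1) * (A * B * (poch (d - A) n * poch (d - B) n)) := by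
    rw [sum_antidiagonal_choose_mul_fst n fun i m =>
      poch A i * poch B i * poch (d - 1 - A - B) m * poch (d + i) m]
    have h := sum_poch_saalschutz n (A + 1) (B + 1) (d + 1)
    rw [add_sub_add_right_eq_sub, add_sub_add_right_eq_sub] at h
    rw [← h, Finset.mul_sum _ _ (A * B)]
    congr 1
    refine Finset.sum_congr rfl fun x _ => ?_
    rw [poch_succ_left, poch_succ_left, show d - A - (B + 1) = d - 1 - A - B by ring]
    push_cast
    rw [show d + ((x.1 : ℂ) + 1) = d + 1 + x.1 by ring]
    ring
  have hsnd : ∑ x ∈ antidiagonal (n + 1), ((n + 1).choose x.1 : ℂ) *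
      (x.2 * (poch A x.1 * poch B x.1 * poch (d - A - B) (x.2 - 1) * poch (d + x.1) x.2)) =
      (n + 1) * ((d + n) * (poch (d - A) n * poch (d - B) n)) := by
    rw [sum_antidiagonal_choose_mul_snd n fun i m =>
      poch A i * poch B i * poch (d - A - B) (m - 1) * poch (d + i) m,
      ← sum_poch_saalschutz n A B d, Finset.mul_sum _ _ (d + (n : ℂ))]
    congr 1
    refine Finset.sum_congr rfl fun x hx => ?_
    have hx : (x.1 : ℂ) + x.2 = n := by exact_mod_cast mem_antidiagonal.1 hx
    rw [poch_succ, ← hx]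
    simp
    ring
  have hsum := sum_poch_saalschutz (n + 1) A B d
  have hsplit : ∑ x ∈ antidiagonal (n + 1), ((n + 1).choose x.1 : ℂ) *
        (poch A x.1 * poch B x.1 * poch (d - 1 - A - B) x.2 * poch (d + x.1) x.2 *
          (γ + x.1)) =
      γ * (poch (d - A) (n + 1) * poch (d - B) (n + 1)) -
        γ * ((n + 1) * ((d + n) * (poch (d - A) n * poch (d - B) n))) +
        (n + 1) * (A * B * (poch (d - A) n * poch (d - B) n)) := by
    rw [← hfst, ← hsnd, ← hsum, Finset.mul_sum, Finset.mul_sum, ← Finset.sum_sub_distrib,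
      ← Finset.sum_add_distrib]
    refine Finset.sum_congr rfl fun x _ => ?_
    have h := poch_add_one_eq (d - 1 - A - B) x.2
    rw [show d - 1 - A - B + 1 = d - A - B by ring] at h
    rw [h]
    ring
  rw [hsplit, poch_succ, poch_succ]
  ring

theorem poch_add_one_div {a : ℂ} {k : ℕ} (ha : a ≠ 0) (hk : poch a k ≠ 0) :
    poch (a + 1) k / poch a k = (a + k) / a := by
  rw [div_eq_div_iff hk ha]
  linear_combination mul_poch_add_one a k

theorem poch_neg_natCast (N m : ℕ) :
    poch (-(N : ℂ)) m = (-1) ^ m * (m.factorial * N.choose m) := by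
  rw [poch, ascPochhammer_eval_neg_eq_descPochhammer, descPochhammer_eval_eq_descFactorial,
    Nat.descFactorial_eq_factorial_mul_choose]
  push_cast
  ring

/-- Coefficient form of the Euler transformation of a `₃F₂` with an extra pair of parameters
differing by one. -/
theorem poch_ratio_eq_sum_antidiagonal (k : ℕ) (A B d p γ : ℂ) (hp : p ≠ 0) (hγ : γ ≠ 0)
    (hpγ : p * (A * B + γ * (d - 1 - A - B)) = γ * (d - 1 - A) * (d - 1 - B))
    (hd : poch d k ≠ 0) :
    poch (d - 1 - A) k * poch (d - 1 - B) k * (p + k) / (k.factorial * poch d k * p) =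
      ∑ x ∈ antidiagonal k, poch A x.1 * poch B x.1 * (γ + x.1) /
        (x.1.factorial * poch d x.1 * γ) * (poch (d - 1 - A - B) x.2 / x.2.factorial) := by
  have hsum : p * ∑ x ∈ antidiagonal k, (k.choose x.1 : ℂ) *
      (poch A x.1 * poch B x.1 * poch (d - 1 - A - B) x.2 * poch (d + x.1) x.2 * (γ + x.1)) =
      poch (d - 1 - A) k * poch (d - 1 - B) k * (γ * (p + k)) := by
    cases k with
    | zero => simp [poch_zero]; ring
    | succ n =>
      rw [sum_poch_saalschutz_extended, poch_succ_left, poch_succ_left,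
        show d - 1 - A + 1 = d - A by ring, show d - 1 - B + 1 = d - B by ring]
      push_cast
      linear_combination (n + 1) * poch (d - A) n * poch (d - B) n * hpγ
  have hk : (k.factorial : ℂ) ≠ 0 := by exact_mod_cast k.factorial_ne_zero
  have hterm : ∑ x ∈ antidiagonal k, poch A x.1 * poch B x.1 * (γ + x.1) /
        (x.1.factorial * poch d x.1 * γ) * (poch (d - 1 - A - B) x.2 / x.2.factorial) =
      (∑ x ∈ antidiagonal k, (k.choose x.1 : ℂ) *
        (poch A x.1 * poch B x.1 * poch (d - 1 - A - B) x.2 * poch (d + x.1) x.2 *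
          (γ + x.1))) / (k.factorial * poch d k * γ) := by
    rw [Finset.sum_div]
    refine Finset.sum_congr rfl fun x hx => ?_
    have hx := mem_antidiagonal.1 hx
    have hfac : (k.choose x.1 : ℂ) * x.1.factorial * x.2.factorial = k.factorial := by
      rw [← hx]
      rw [Nat.choose_symm_add]
      exact_mod_cast Nat.add_choose_mul_factorial_mul_factorial x.1 x.2
    have hdk : poch d k = poch d x.1 * poch (d + x.1) x.2 := by rw [← hx, poch_add]
    have h1 : (x.1.factorial : ℂ) ≠ 0 := by exact_mod_cast x.1.factorial_ne_zero
    have h2 : (x.2.factorial : ℂ) ≠ 0 := by exact_mod_cast x.2.factorial_ne_zero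
    have h3 : poch d x.1 ≠ 0 := by rw [hdk] at hd; exact left_ne_zero_of_mul hd
    rw [div_mul_div_comm, div_eq_div_iff (by positivity) (by positivity), hdk, ← hfac]
    ring
  rw [hterm, div_eq_div_iff (by positivity) (by positivity)]
  linear_combination -(k.factorial * poch d k) * hsum

theorem sum_poch_saalschutz_alternating (N : ℕ) (s c e f q : ℂ) (h : e + f = s + c - N + 2) :
    (e - c - 1) * (f - c - 1) * ∑ x ∈ antidiagonal N, (N.choose x.1 : ℂ) *
        ((-1) ^ x.1 * poch s x.1 * poch c x.1 * poch (e + x.1) x.2 * poch (f + x.1) x.2 *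
          (q + x.1)) =
      poch (e - c - 1) N * poch (f - c - 1) N *
        (q * ((e - c - 1) * (f - c - 1)) - N * (s * (c - q))) := by
  cases N with
  | zero => simp [poch_zero]; ring
  | succ n =>
    have hsum := sum_poch_saalschutz_extended n s c e q
    have hterm : ∑ x ∈ antidiagonal (n + 1), ((n + 1).choose x.1 : ℂ) *
        ((-1) ^ x.1 * poch s x.1 * poch c x.1 * poch (e + x.1) x.2 * poch (f + x.1) x.2 *
          (q + x.1)) = (-1) ^ (n + 1) * ∑ x ∈ antidiagonal (n + 1), ((n + 1).choose x.1 : ℂ) *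
        (poch s x.1 * poch c x.1 * poch (e - 1 - s - c) x.2 * poch (e + x.1) x.2 *
          (q + x.1)) := by
      rw [Finset.mul_sum]
      refine Finset.sum_congr rfl fun x hx => ?_
      have hx := mem_antidiagonal.1 hx
      have hc : (x.1 : ℂ) + x.2 = (n + 1 : ℕ) := by exact_mod_cast hx
      rw [poch_reflect (e - 1 - s - c), show 1 - (e - 1 - s - c) - x.2 = f + x.1 by
        linear_combination -hc - h, ← hx, pow_add]
      linear_combination -((x.1 + x.2).choose x.1 * ((-1) ^ x.1 * poch s x.1 * poch c x.1 *
        poch (e + x.1) x.2 * poch (f + x.1) x.2 * (q + x.1))) *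
        (pow_mul_pow_eq_one x.2 (show (-1 : ℂ) * -1 = 1 by norm_num))
    push_cast at h
    rw [hterm, hsum, poch_succ_left, poch_succ_left, sub_add_cancel, sub_add_cancel,
      poch_reflect (e - s), show 1 - (e - s) - n = f - c by linear_combination -h,
      show s = e + f - c + (n + 1) - 2 by linear_combination -h]
    have hpow := pow_mul_pow_eq_one n (show (-1 : ℂ) * -1 = 1 by norm_num)
    push_cast
    rw [pow_succ]
    linear_combination ((e - c - 1) * (f - c - 1) * poch (e - c) n * poch (f - c) n *
        (q * ((e - c - 1) * (f - c - 1)) - (n + 1) * ((e + f - c + (n + 1) - 2) * (c - q)))) * hpow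

/-- A Saalschützian sum whose index is shifted by `j`. -/
theorem sum_poch_saalschutz_shifted (j N : ℕ) (s c e f q : ℂ)
    (h : e + f = s + c - (j + N : ℕ) + 2) (hEF : (e - c - 1) * (f - c - 1) ≠ 0)
    (hq : q ≠ 0) (he : poch e (j + N) ≠ 0) (hf : poch f (j + N) ≠ 0) :
    ∑ x ∈ antidiagonal N, poch s x.1 / x.1.factorial *
        (poch c (j + x.1) * poch (-((j + N : ℕ) : ℂ)) (j + x.1) * (q + (j + x.1 : ℕ)) /
          (poch e (j + x.1) * poch f (j + x.1) * q)) =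
      poch c j * poch (-((j + N : ℕ) : ℂ)) j * (poch (e - c - 1) N * poch (f - c - 1) N *
        ((q + j) * ((e - c - 1) * (f - c - 1)) - N * (s * (c - q)))) /
        ((e - c - 1) * (f - c - 1) * (poch e (j + N) * poch f (j + N) * q)) := by
  have hsum := sum_poch_saalschutz_alternating N s (c + j) (e + j) (f + j) (q + j)
    (by push_cast at h; linear_combination h)
  rw [add_sub_add_right_eq_sub, add_sub_add_right_eq_sub, add_sub_add_right_eq_sub] at hsum
  rw [← hsum, Finset.mul_sum, Finset.mul_sum, Finset.sum_div]
  refine Finset.sum_congr rfl fun x hx => ?_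
  have hx := mem_antidiagonal.1 hx
  have he' : poch e (j + N) = poch e (j + x.1) * poch (e + j + x.1) x.2 := by
    rw [← hx, ← add_assoc, poch_add e (j + x.1)]; push_cast; rw [add_assoc e]
  have hf' : poch f (j + N) = poch f (j + x.1) * poch (f + j + x.1) x.2 := by
    rw [← hx, ← add_assoc, poch_add f (j + x.1)]; push_cast; rw [add_assoc f]
  rw [he'] at he ⊢
  rw [hf'] at hf ⊢
  have he1 := left_ne_zero_of_mul he
  have he2 := right_ne_zero_of_mul he
  have hf1 := left_ne_zero_of_mul hf
  have hf2 := right_ne_zero_of_mul hf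
  have h1 : (x.1.factorial : ℂ) ≠ 0 := by exact_mod_cast x.1.factorial_ne_zero
  rw [poch_add (-((j + N : ℕ) : ℂ)) j, show -((j + N : ℕ) : ℂ) + j = -N by push_cast; ring,
    poch_neg_natCast N, poch_add c j, div_mul_div_comm,
    div_eq_div_iff (by positivity) (by positivity)]
  push_cast
  ring

theorem proposition_12P2 (n : ℕ) (a b c d e f p q : ℂ)
    (hsaal : d + e + f - a - b - c + (n : ℂ) = 3)
    (hαd : (c - q) * (d - a - b - 1) ≠ 0)
    (hγd : a * b + p * (d - a - b - 1) ≠ 0)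
    (hδd : (e - c - 1) * (f - c - 1) - (c - q) * (d - a - b - 1) ≠ 0)
    (α γ δ : ℂ)
    (hα : α = q * (e - c - 1) * (f - c - 1) / ((c - q) * (d - a - b - 1)))
    (hγ : γ = p * (d - a - 1) * (d - b - 1) / (a * b + p * (d - a - b - 1)))
    (hδ : δ = (q * (e - c - 1) * (f - c - 1) + (n : ℂ) * (c - q) * (d - a - b - 1)) /
        ((e - c - 1) * (f - c - 1) - (c - q) * (d - a - b - 1)))
    (hnd : ∀ z ∈ [d, e, f, p, q, 2 + c - e - (n : ℂ), 2 + c - f - (n : ℂ), γ, δ, α],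
      ∀ k ≤ n, poch z k ≠ 0) :
    hypTerm [a, b, c, p + 1, q + 1] [d, e, f, p, q] n 1
      = poch (e - c - 1) n * poch (f - c - 1) n * poch (α + 1) n /
          (poch e n * poch f n * poch α n) *
        hypTerm [d - a - 1, d - b - 1, c, γ + 1, δ + 1]
          [d, 2 + c - e - (n : ℂ), 2 + c - f - (n : ℂ), γ, δ] n 1 := by
  have hne : ∀ z ∈ [d, e, f, p, q, 2 + c - e - (n : ℂ), 2 + c - f - (n : ℂ), γ, δ, α],
      n ≠ 0 → z ≠ 0 := fun z hz hn => by
    simpa [poch] using hnd z hz 1 (Nat.one_le_iff_ne_zero.2 hn)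
  rcases eq_or_ne n 0 with rfl | hn
  · simp [hypTerm, poch]
  simp only [List.forall_mem_cons, hn, ne_eq, not_false_eq_true, forall_const] at hne hnd
  obtain ⟨hd0, he0, hf0, hp0, hq0, -, -, hγ0, hδ0, hα0, -⟩ := hne
  obtain ⟨hdk, hek, hfk, hpk, hqk, hE', hF', hγk, hδk, hαk, -⟩ := hnd
  have hEF : (e - c - 1) * (f - c - 1) ≠ 0 := fun h0 => hα0 <| by
    rw [hα, mul_assoc q, h0, mul_zero, zero_div]
  have hpγ : p * ((d - a - 1) * (d - b - 1) + γ * (d - 1 - (d - a - 1) - (d - b - 1))) =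
      γ * (d - 1 - (d - a - 1)) * (d - 1 - (d - b - 1)) := by
    rw [eq_div_iff hγd] at hγ
    linear_combination -hγ
  have hda : d - 1 - (d - a - 1) = a := by ring
  have hdb : d - 1 - (d - b - 1) = b := by ring
  have hs : d - 1 - (d - a - 1) - (d - b - 1) = a + b + 1 - d := by ring
  let B : ℕ → ℂ := fun j => poch (d - a - 1) j * poch (d - b - 1) j * (γ + j) /
    (j.factorial * poch d j * γ)
  let S : ℕ → ℂ := fun m => poch (a + b + 1 - d) m / m.factorial
  let H : ℕ → ℂ := fun k => poch c k * poch (-(n : ℂ)) k * (q + k) /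
    (poch e k * poch f k * q)
  have hlhs : hypTerm [a, b, c, p + 1, q + 1] [d, e, f, p, q] n 1 =
      ∑ k ∈ Finset.range (n + 1), ∑ j ∈ Finset.range (k + 1),
        B j * (S (k - j) * H (j + (k - j))) := by
    refine Finset.sum_congr rfl fun k hk => ?_
    have hk := Nat.lt_succ_iff.1 (Finset.mem_range.1 hk)
    have h := poch_ratio_eq_sum_antidiagonal k (d - a - 1) (d - b - 1) d p γ hp0 hγ0 hpγ
      (hdk k hk)
    rw [hs, hda, hdb, Finset.Nat.sum_antidiagonal_eq_sum_range_succ_mk] at h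
    have hr : ∑ j ∈ Finset.range (k + 1), B j * (S (k - j) * H (j + (k - j))) =
        (∑ j ∈ Finset.range (k + 1), B j * S (k - j)) * H k := by
      rw [Finset.sum_mul]
      refine Finset.sum_congr rfl fun j hj => ?_
      rw [Nat.add_sub_cancel' (Nat.lt_succ_iff.1 (Finset.mem_range.1 hj)), mul_assoc]
    rw [hr, ← h]
    have hp' := poch_add_one_div hp0 (hpk k hk)
    have hq' := poch_add_one_div hq0 (hqk k hk)
    calc _ = poch a k * poch b k * poch c k * poch (-(n : ℂ)) k /
          (k.factorial * poch d k * poch e k * poch f k) *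
          (poch (p + 1) k / poch p k) * (poch (q + 1) k / poch q k) := by
            simp only [List.map_cons, List.map_nil, List.prod_cons, List.prod_nil]
            ring
      _ = _ := by
            rw [hp', hq']
            simp only [H]
            ring
  rw [hlhs, Finset.sum_range_diag_flip (n + 1) fun j m => B j * (S m * H (j + m)), hypTerm,
    Finset.mul_sum]
  refine Finset.sum_congr rfl fun j hj => ?_
  obtain ⟨N, rfl⟩ := Nat.exists_eq_add_of_le (Nat.lt_succ_iff.1 (Finset.mem_range.1 hj))
  have htail := sum_poch_saalschutz_shifted j N (a + b + 1 - d) c e f q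
    (by linear_combination hsaal) hEF hq0 (hek _ le_rfl) (hfk _ le_rfl)
  rw [Finset.Nat.sum_antidiagonal_eq_sum_range_succ_mk] at htail
  rw [← Finset.mul_sum, show j + N + 1 - j = N + 1 by lia]
  simp only [S, H, htail]
  have hjn : j ≤ j + N := Nat.le_add_right j N
  have hα' := poch_add_one_div hα0 (hαk _ le_rfl)
  have hγ' := poch_add_one_div hγ0 (hγk j hjn)
  have hδ' := poch_add_one_div hδ0 (hδk j hjn)
  obtain ⟨u, hu, hrefl⟩ : ∃ u : ℂ, u * u = 1 ∧
      ∀ x : ℂ, poch (2 + c - x - (j + N : ℕ)) j = u * poch (x - c - 1 + N) j := by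
    refine ⟨(-1) ^ j, by rw [← mul_pow]; simp, fun x => ?_⟩
    rw [poch_reflect]
    congr 2
    push_cast
    ring
  have hE := hE' j hjn
  have hF := hF' j hjn
  rw [hrefl] at hE hF
  have hE1 := right_ne_zero_of_mul hE
  have hF1 := right_ne_zero_of_mul hF
  have hsplit : ∀ x : ℂ, poch x (j + N) = poch x N * poch (x + N) j := by
    intro x
    rw [add_comm j N, poch_add]
  have hkey : q * (α + (j + N : ℕ)) * (δ + j) * ((e - c - 1) * (f - c - 1)) =
      ((q + j) * ((e - c - 1) * (f - c - 1)) - N * ((a + b + 1 - d) * (c - q))) * (α * δ) := by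
    rw [eq_div_iff hαd] at hα
    rw [eq_div_iff hδd] at hδ
    push_cast at hδ ⊢
    refine mul_left_cancel₀ hαd ?_
    linear_combination (q * ((e - c - 1) * (f - c - 1)) * (δ + j) -
        δ * ((q + j) * ((e - c - 1) * (f - c - 1)) - N * ((a + b + 1 - d) * (c - q)))) * hα -
      q * ((e - c - 1) * (f - c - 1)) * j * hδ
  have hcore : ((q + j) * ((e - c - 1) * (f - c - 1)) - N * ((a + b + 1 - d) * (c - q))) /
      ((e - c - 1) * (f - c - 1) * q) =
      ((α + (j + N : ℕ)) / α) * ((δ + j) / δ) := by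
    rw [div_mul_div_comm, div_eq_div_iff (by positivity) (by positivity)]
    linear_combination -hkey
  calc _ = B j * (poch c j * poch (-((j + N : ℕ) : ℂ)) j *
        (poch (e - c - 1) N * poch (f - c - 1) N) / (poch e (j + N) * poch f (j + N))) *
        (((q + j) * ((e - c - 1) * (f - c - 1)) - N * ((a + b + 1 - d) * (c - q))) /
      ((e - c - 1) * (f - c - 1) * q)) := by
          generalize (e - c - 1) * (f - c - 1) = M
          ring
    _ = poch (d - a - 1) j * poch (d - b - 1) j /
        (j.factorial * poch d j) * (poch c j * poch (-((j + N : ℕ) : ℂ)) j *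
        (poch (e - c - 1) N * poch (f - c - 1) N) / (poch e (j + N) * poch f (j + N))) *
        ((poch (α + 1) (j + N) / poch α (j + N)) * (poch (δ + 1) j / poch δ j)) *
        (poch (γ + 1) j / poch γ j) * (1 / (u * u)) *
        ((poch (e - c - 1 + N) j / poch (e - c - 1 + N) j) *
          (poch (f - c - 1 + N) j / poch (f - c - 1 + N) j)) := by
          rw [hcore, hα', hδ', hγ', hu, div_self hE1, div_self hF1]
          simp only [B]
          ring
    _ = _ := by
          simp only [List.map_cons, List.map_nil, List.prod_cons, List.prod_nil]
          rw [hrefl, hrefl, hsplit (e - c - 1), hsplit (f - c - 1)]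
          ring
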